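/- For every n×n density matrix ρ, the trace distance of coherence satisfies C_tr(ρ) = min_{δ incoherent} ‖ρ − δ‖_tr ≤ 2 − 2/n. -/

import Mathlib

open Matrix BigOperators
open scoped ComplexOrder

/-- The trace norm of a Hermitian matrix: the sum of the absolute values of its
eigenvalues (junk value `0` for non-Hermitian matrices). -/
noncomputable def traceNorm {m : Type*} [Fintype m] [DecidableEq m] (A : Matrix m m ℂ) : ℝ :=
  if h : A.IsHermitian then ∑ i, |h.eigenvalues i| else 0

/-- The operator norm of a Hermitian matrix: the maximum of the absolute values of its
eigenvalues (junk value `0` for non-Hermitian matrices). -/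
noncomputable def opNorm {m : Type*} [Fintype m] [DecidableEq m] (A : Matrix m m ℂ) : ℝ :=
  if h : A.IsHermitian then ⨆ i, |h.eigenvalues i| else 0

/-- A density matrix: positive semidefinite with trace 1. -/
def IsDensity {m : Type*} [Fintype m] (A : Matrix m m ℂ) : Prop :=
  A.PosSemidef ∧ A.trace = 1

/-- An incoherent state: a diagonal density matrix. -/
def IsIncoherent {m : Type*} [Fintype m] [DecidableEq m] (A : Matrix m m ℂ) : Prop :=
  IsDensity A ∧ ∀ i j, i ≠ j → A i j = 0

/-- `|x⟩⟨x|`, the rank-one matrix with `(i,j)` entry `x i * conj (x j)`. -/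
def outer {m : Type*} (x : m → ℂ) : Matrix m m ℂ :=
  Matrix.of fun i j => x i * star (x j)

/-- If `A ≤ P` with `P` positive semidefinite, then `‖A‖_tr ≤ 2 tr P - tr A`. -/
lemma traceNorm_le_of_posSemidef_sub {m : Type*} [Fintype m] [DecidableEq m]
    {A P : Matrix m m ℂ} (hA : A.IsHermitian) (hP : P.PosSemidef) (hPA : (P - A).PosSemidef) :
    traceNorm A ≤ 2 * P.trace.re - A.trace.re := by
  set U : Matrix m m ℂ := (hA.eigenvectorUnitary : Matrix m m ℂ) with hU
  have hUU : U * Uᴴ = 1 := (Matrix.mem_unitaryGroup_iff).1 hA.eigenvectorUnitary.2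
  have hdiag : ∀ i, (Uᴴ * A * U) i i = (hA.eigenvalues i : ℂ) := fun i => by
    have h : Uᴴ * A * U = diagonal (RCLike.ofReal ∘ hA.eigenvalues) := by
      simpa [hU, Unitary.conjStarAlgAut_apply, star_eq_conjTranspose] using
        hA.conjStarAlgAut_star_eigenvectorUnitary
    simp [h]
  have htr : ∀ M : Matrix m m ℂ, ∑ i, ((Uᴴ * M * U) i i).re = M.trace.re := fun M => by
    have h : (Uᴴ * M * U).trace = M.trace := by
      rw [Matrix.trace_mul_comm, ← Matrix.mul_assoc, hUU, Matrix.one_mul]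
    rw [← h, Matrix.trace, Complex.re_sum]
    rfl
  rw [traceNorm, dif_pos hA, ← htr P, ← htr A, Finset.mul_sum, ← Finset.sum_sub_distrib]
  refine Finset.sum_le_sum fun i _ => ?_
  have h1 := (Complex.nonneg_iff.1 ((hP.conjTranspose_mul_mul_same U).diag_nonneg (i := i))).1
  have h2 := (Complex.nonneg_iff.1 ((hPA.conjTranspose_mul_mul_same U).diag_nonneg (i := i))).1
  rw [Matrix.mul_sub, Matrix.sub_mul, Matrix.sub_apply, Complex.sub_re, hdiag,
    Complex.ofReal_re] at h2
  rw [hdiag, Complex.ofReal_re]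
  exact abs_le.2 ⟨by linarith, by linarith⟩

open scoped MatrixOrder Matrix.Norms.L2Operator in
lemma Matrix.PosSemidef.exists_eq_conjTranspose_mul_self {m : Type*} [Fintype m] [DecidableEq m]
    {A : Matrix m m ℂ} (hA : A.PosSemidef) : ∃ B : Matrix m m ℂ, A = Bᴴ * B :=
  CStarAlgebra.nonneg_iff_eq_star_mul_self.1 hA.nonneg

/-- The pinching inequality `A ≤ n • diag A` for a positive semidefinite `n × n` matrix. -/
lemma posSemidef_card_smul_diagonal_sub {m : Type*} [Fintype m] [DecidableEq m]
    {A : Matrix m m ℂ} (hA : A.PosSemidef) :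
    ((Fintype.card m : ℂ) • diagonal A.diag - A).PosSemidef := by
  obtain ⟨B, rfl⟩ := hA.exists_eq_conjTranspose_mul_self
  have hdiag : (diagonal (Bᴴ * B).diag).IsHermitian :=
    isHermitian_diagonal_iff.2 fun i => hA.isHermitian.apply i i
  refine .of_dotProduct_mulVec_nonneg ((hdiag.smul (by simp [IsSelfAdjoint])).sub hA.isHermitian)
    fun x => ?_
  have hleft : star x ⬝ᵥ (Bᴴ * B) *ᵥ x = ((∑ k, ‖∑ i, B k i * x i‖ ^ 2 : ℝ) : ℂ) := by
    rw [← Matrix.mulVec_mulVec, Matrix.dotProduct_mulVec, ← Matrix.star_mulVec]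
    simp [dotProduct, mulVec, Complex.conj_mul', ← map_mul, ← map_sum]
  have hright : star x ⬝ᵥ diagonal (Bᴴ * B).diag *ᵥ x
      = ((∑ k, ∑ i, ‖B k i * x i‖ ^ 2 : ℝ) : ℂ) := by
    rw [Finset.sum_comm]
    simp only [dotProduct, mulVec_diagonal, diag_apply, mul_apply, conjTranspose_apply,
      Pi.star_apply, RCLike.star_def, Complex.ofReal_sum, Complex.ofReal_pow, ← Complex.conj_mul',
      map_mul, Finset.sum_mul, Finset.mul_sum]
    exact Finset.sum_congr rfl fun i _ => Finset.sum_congr rfl fun k _ => by ring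
  rw [sub_mulVec, dotProduct_sub, smul_mulVec, dotProduct_smul, hleft, hright, smul_eq_mul,
    sub_nonneg, ← Complex.ofReal_natCast, ← Complex.ofReal_mul, Complex.real_le_real,
    Finset.mul_sum]
  refine Finset.sum_le_sum fun k _ => ?_
  calc ‖∑ i, B k i * x i‖ ^ 2 ≤ (∑ i, ‖B k i * x i‖) ^ 2 := by gcongr; exact norm_sum_le _ _
    _ ≤ Fintype.card m * ∑ i, ‖B k i * x i‖ ^ 2 := sq_sum_le_card_mul_sum_sq

lemma traceNorm_nonneg {m : Type*} [Fintype m] [DecidableEq m] (A : Matrix m m ℂ) :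
    0 ≤ traceNorm A := by
  unfold traceNorm
  split_ifs
  · exact Finset.sum_nonneg fun _ _ => abs_nonneg _
  · exact le_rfl

lemma IsDensity.isIncoherent_diagonal {m : Type*} [Fintype m] [DecidableEq m]
    {ρ : Matrix m m ℂ} (hρ : IsDensity ρ) : IsIncoherent (diagonal ρ.diag) :=
  ⟨⟨.diagonal fun _ => hρ.1.diag_nonneg, by rw [trace_diagonal]; exact hρ.2⟩,
    fun _ _ h => diagonal_apply_ne _ h⟩

/-- for every `n × n` density matrix `ρ`, the trace distance of coherence
`C_tr(ρ) = min_{δ incoherent} ‖ρ − δ‖_tr` is at most `2 − 2/n`. -/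
theorem stmt12 {n : ℕ} (ρ : Matrix (Fin n) (Fin n) ℂ) (hρ : IsDensity ρ) :
    sInf {r : ℝ | ∃ δ, IsIncoherent δ ∧ r = traceNorm (ρ - δ)} ≤ 2 - 2 / n := by
  rcases Nat.eq_zero_or_pos n with rfl | hn
  · simpa [Matrix.trace] using hρ.2
  have hn1 : (1 : ℝ) ≤ n := by exact_mod_cast hn
  have hδ := hρ.isIncoherent_diagonal
  set δ : Matrix (Fin n) (Fin n) ℂ := diagonal ρ.diag with hδdef
  have hsub : ((1 - (n : ℝ)⁻¹) • ρ - (ρ - δ)).PosSemidef := by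
    have h := (posSemidef_card_smul_diagonal_sub hρ.1).smul
      (show (0 : ℝ) ≤ (n : ℝ)⁻¹ by positivity)
    convert h using 1
    ext i j
    have hn0 : (n : ℂ) ≠ 0 := by exact_mod_cast hn.ne'
    simp [← hδdef]
    field_simp
    ring
  have hle := traceNorm_le_of_posSemidef_sub (hρ.1.isHermitian.sub hδ.1.1.isHermitian)
    (hρ.1.smul (sub_nonneg.2 (inv_le_one_of_one_le₀ hn1))) hsub
  rw [trace_smul, trace_sub, hρ.2, hδ.1.2] at hle
  refine le_trans (csInf_le ⟨0, ?_⟩ ⟨δ, hδ, rfl⟩) (hle.trans_eq ?_)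
  · rintro _ ⟨_, _, rfl⟩
    exact traceNorm_nonneg _
  · simp
    ring
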